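/- Let (F, M) be a 2-dimensional Euclidean lattice that is not stable. Then for every Euclidean lattice (E, L), H_min of the tensor product of (E, L) and (F, M) equals H_min(E, L)·H_min(F, M). -/

import Mathlib

open Module

noncomputable section

namespace EucLat

variable {E : Type*} [NormedAddCommGroup E] [InnerProductSpace ℝ E]

/-- The covolume of a `ℤ`-submodule of a real inner product space: the square root of the
Gram determinant of a `ℤ`-basis (junk value `0` if no finite basis exists). -/
def covol (L : Submodule ℤ E) : ℝ :=
  @dite _ (∃ n : ℕ, Nonempty (Basis (Fin n) ℤ L)) (Classical.propDecidable _)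
    (fun h => Real.sqrt (Matrix.det (Matrix.of fun i j =>
      (inner ℝ ((h.choose_spec.some i : L) : E) ((h.choose_spec.some j : L) : E) : ℝ))))
    (fun _ => 0)

/-- The reduced height `covol(L)^(1/dim E)` of a full lattice. -/
def redH (L : Submodule ℤ E) : ℝ := covol L ^ ((finrank ℝ E : ℝ)⁻¹)

/-- The lattice `L ∩ F` induced on a subspace `F`. -/
def latIn (L : Submodule ℤ E) (F : Submodule ℝ E) : Submodule ℤ F :=
  L.comap (F.subtype.restrictScalars ℤ)

/-- The reduced height of a subspace: `covol(F ∩ L)^(1/dim F)`. -/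
def Hr (L : Submodule ℤ E) (F : Submodule ℝ E) : ℝ := redH (latIn L F)

/-- A subspace is rational if it is spanned by its intersection with the lattice. -/
def IsRational (L : Submodule ℤ E) (F : Submodule ℝ E) : Prop :=
  Submodule.span ℝ ((L : Set E) ∩ (F : Set E)) = F

/-- `(E, L)` is a Euclidean lattice: `L` is discrete and spans `E` over `ℝ`. -/
def IsLat (L : Submodule ℤ E) : Prop :=
  DiscreteTopology L ∧ Submodule.span ℝ (L : Set E) = ⊤

/-- Minimal reduced height: infimum of reduced heights of nonzero rational subspaces. -/
def Hmin (L : Submodule ℤ E) : ℝ :=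
  sInf {h : ℝ | ∃ F : Submodule ℝ E, F ≠ ⊥ ∧ IsRational L F ∧ h = Hr L F}

/-- Semistability of a Euclidean lattice. -/
def Semistable (L : Submodule ℤ E) : Prop :=
  ∀ F : Submodule ℝ E, F ≠ ⊥ → IsRational L F → redH L ≤ Hr L F

/-- Stability of a Euclidean lattice. -/
def Stable (L : Submodule ℤ E) : Prop :=
  Semistable L ∧ ∀ F : Submodule ℝ E, F ≠ ⊥ → F ≠ ⊤ → IsRational L F → redH L < Hr L F

/-- The quotient lattice of `(E, L)` by a subspace `F`: the image of `L` under the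
orthogonal projection of `E` onto `Fᗮ`. -/
def quotLat [FiniteDimensional ℝ E] (L : Submodule ℤ E) (F : Submodule ℝ E) :
    Submodule ℤ Fᗮ :=
  L.map ((Submodule.orthogonalProjectionOnto Fᗮ : E →ₗ[ℝ] Fᗮ).restrictScalars ℤ)

/-- For subspaces `F ≤ F'`, the successive quotient lattice: the image of `F' ∩ L` under the
orthogonal projection of `F'` onto the orthogonal complement of `F` inside `F'`. -/
def succQuot [FiniteDimensional ℝ E] (L : Submodule ℤ E) (F F' : Submodule ℝ E) :
    Submodule ℤ ((F.comap F'.subtype)ᗮ) :=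
  quotLat (latIn L F') (F.comap F'.subtype)

/-- A GS-flag of `(E, L)`. -/
def IsGSFlag [FiniteDimensional ℝ E] (L : Submodule ℤ E) {ℓ : ℕ}
    (C : Fin (ℓ + 1) → Submodule ℝ E) : Prop :=
  C 0 = ⊥ ∧ C (Fin.last ℓ) = ⊤ ∧
  (∀ i : Fin ℓ, C i.castSucc < C i.succ) ∧
  (∀ i, IsRational L (C i)) ∧
  (∀ i : Fin ℓ, Semistable (succQuot L (C i.castSucc) (C i.succ))) ∧
  (∀ i j : Fin ℓ, i < j →
    redH (succQuot L (C i.castSucc) (C i.succ)) < redH (succQuot L (C j.castSucc) (C j.succ)))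

/-- The dual lattice `L* = {y : ⟪x, y⟫ ∈ ℤ for all x ∈ L}`. -/
def dualLat (L : Submodule ℤ E) : Submodule ℤ E where
  carrier := {y | ∀ x ∈ L, ∃ n : ℤ, (inner ℝ x y : ℝ) = n}
  zero_mem' := fun x _ => ⟨0, by simp⟩
  add_mem' := by
    intro a b ha hb x hx
    obtain ⟨m, hm⟩ := ha x hx
    obtain ⟨n, hn⟩ := hb x hx
    exact ⟨m + n, by rw [inner_add_right, hm, hn]; push_cast; ring⟩
  smul_mem' := by
    intro z y hy x hx
    obtain ⟨n, hn⟩ := hy x hx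
    refine ⟨z * n, ?_⟩
    rw [← Int.cast_smul_eq_zsmul ℝ, real_inner_smul_right, hn]
    push_cast; ring

/-- `(E, L)` is isodual via the similarity `τ`. -/
def IsIsodual (L : Submodule ℤ E) (τ : E →ₗ[ℝ] E) : Prop :=
  (∃ α : ℝ, 0 < α ∧ ∀ x y : E, (inner ℝ (τ x) (τ y) : ℝ) = α * inner ℝ x y) ∧
  L.map (τ.restrictScalars ℤ) = dualLat L

/-- The bilinear form `b_τ(x, y) = ⟪τ x, y⟫` associated with an isoduality. -/
def bform (τ : E →ₗ[ℝ] E) (x y : E) : ℝ := inner ℝ (τ x) y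

/-- `b` has signature `s`: there is a `b`-orthogonal basis with `p - q = s`. -/
def HasSignature (b : E → E → ℝ) (s : ℤ) : Prop :=
  ∃ (n : ℕ) (v : Basis (Fin n) ℝ E),
    (∀ i j, i ≠ j → b (v i) (v j) = 0) ∧
    s = ((Finset.univ.filter fun i => 0 < b (v i) (v i)).card : ℤ) -
        ((Finset.univ.filter fun i => b (v i) (v i) < 0).card : ℤ)

/-- The destabilizing subspace of `(E, L)`. -/
def IsDestabilizing (L : Submodule ℤ E) (F : Submodule ℝ E) : Prop :=
  F ≠ ⊥ ∧ IsRational L F ∧ Hr L F = Hmin L ∧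
  ∀ F' : Submodule ℝ E, F' ≠ ⊥ → IsRational L F' → Hr L F' = Hmin L → F' ≤ F

/-- `(G, t)` is a realization of the tensor product of the inner product spaces `E` and `F`:
`t` induces a linear isomorphism `E ⊗ F ≃ G` and
`⟪t x y, t x' y'⟫ = ⟪x, x'⟫ * ⟪y, y'⟫` on pure tensors. -/
def IsTensor {F G : Type*} [NormedAddCommGroup F] [InnerProductSpace ℝ F]
    [NormedAddCommGroup G] [InnerProductSpace ℝ G] (t : E →ₗ[ℝ] F →ₗ[ℝ] G) : Prop :=
  Function.Bijective (TensorProduct.lift t) ∧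
  ∀ (x x' : E) (y y' : F),
    (inner ℝ (t x y) (t x' y') : ℝ) = (inner ℝ x x' : ℝ) * (inner ℝ y y' : ℝ)

/-- The tensor product lattice `L·M`: the additive subgroup generated by pure tensors. -/
def tensorLat {F G : Type*} [NormedAddCommGroup F] [InnerProductSpace ℝ F]
    [NormedAddCommGroup G] [InnerProductSpace ℝ G] (t : E →ₗ[ℝ] F →ₗ[ℝ] G)
    (L : Submodule ℤ E) (M : Submodule ℤ F) : Submodule ℤ G :=
  Submodule.span ℤ (Set.image2 (fun x y => t x y) (L : Set E) (M : Set F))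

/-- `g` is an automorphism of the Euclidean lattice `(E, L)`. -/
def IsAut (L : Submodule ℤ E) (g : E ≃ₗ[ℝ] E) : Prop :=
  (∀ x, x ∈ L ↔ g x ∈ L) ∧ ∀ x y : E, (inner ℝ (g x) (g y) : ℝ) = inner ℝ x y

/-- The direct product lattice `L × L'` inside `WithLp 2 (E × E')`. -/
def prodLat {E' : Type*} [NormedAddCommGroup E'] [InnerProductSpace ℝ E']
    (L : Submodule ℤ E) (L' : Submodule ℤ E') : Submodule ℤ (WithLp 2 (E × E')) :=
  (L.prod L').comap (((WithLp.linearEquiv 2 ℝ (E × E')).restrictScalars ℤ) : WithLp 2 (E × E') →ₗ[ℤ] E × E')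



/-! ### Determinants of Gram matrices -/

lemma one_le_det_one_add {n : Type*} [Fintype n] [DecidableEq n] {Q : Matrix n n ℝ}
    (hQ : Q.PosSemidef) : 1 ≤ (1 + Q).det := by
  have h1 : (1 + Q).IsHermitian := (Matrix.isHermitian_one).add hQ.1
  rw [h1.det_eq_prod_eigenvalues]
  apply Finset.one_le_prod
  intro i _
  have hx := h1.eigenvalues_eq i
  set x := (h1.eigenvectorBasis i) with hxdef
  have hn : ‖x‖ = 1 := h1.eigenvectorBasis.orthonormal.1 i
  have hd : star (x.ofLp) ⬝ᵥ x.ofLp = 1 := by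
    have := real_inner_self_eq_norm_sq x
    rw [hn, EuclideanSpace.inner_eq_star_dotProduct] at this
    rw [dotProduct_comm]; simpa using this
  have h2 := hQ.dotProduct_mulVec_nonneg x.ofLp
  rw [Matrix.add_mulVec, dotProduct_add, Matrix.one_mulVec, hd] at hx
  simp at hx h2 ⊢
  linarith

lemma det_le_det_add {n : Type*} [Fintype n] [DecidableEq n] {P S : Matrix n n ℝ}
    (hP : P.PosDef) (hS : S.PosSemidef) : P.det ≤ (P + S).det := by
  obtain ⟨B, rfl⟩ : ∃ B : Matrix n n ℝ, S = B.conjTranspose * B := by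
    open scoped MatrixOrder Matrix.Norms.L2Operator in
    exact CStarAlgebra.nonneg_iff_eq_star_mul_self.mp hS.nonneg
  have hu : IsUnit P.det := (hP.det_pos).ne'.isUnit
  rw [Matrix.det_add_mul (hA := hu)]
  have := one_le_det_one_add (hP.inv.posSemidef.mul_mul_conjTranspose_same B)
  nlinarith [hP.det_pos]

lemma gram_int_mul {E : Type*} [NormedAddCommGroup E] [InnerProductSpace ℝ E]
    {ι κ : Type*} [Fintype κ] (b : κ → E) (T : Matrix ι κ ℝ) :
    Matrix.gram ℝ (fun i => ∑ k, T i k • b k) = T * Matrix.gram ℝ b * T.transpose := by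
  ext i j
  simp only [Matrix.gram_apply, Matrix.mul_apply, sum_inner, inner_sum, real_inner_smul_left,
    real_inner_smul_right, Matrix.transpose_apply, Finset.sum_mul]
  refine Finset.sum_congr rfl fun k _ => Finset.sum_congr rfl fun l _ => by ring

lemma gram_det_nonneg {E : Type*} [NormedAddCommGroup E] [InnerProductSpace ℝ E]
    {ι : Type*} [Fintype ι] [DecidableEq ι] (b : ι → E) : 0 ≤ (Matrix.gram ℝ b).det :=
  (Matrix.posSemidef_gram ℝ b).det_nonneg

/-- An independent family inside the `ℤ`-span of `b'` has larger Gram determinant. -/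
lemma gram_det_le {E : Type*} [NormedAddCommGroup E] [InnerProductSpace ℝ E]
    {ι : Type*} [Fintype ι] [DecidableEq ι] (b b' : ι → E) (hb : LinearIndependent ℝ b)
    (h : ∀ i, b i ∈ Submodule.span ℤ (Set.range b')) :
    (Matrix.gram ℝ b').det ≤ (Matrix.gram ℝ b).det := by
  have h' : ∀ i, ∃ c : ι → ℤ, ∑ k, c k • b' k = b i := fun i =>
    (Submodule.mem_span_range_iff_exists_fun ℤ).mp (h i)
  choose T hT using h'
  have hb2 : b = fun i => ∑ k, ((Matrix.of T).map (Int.cast : ℤ → ℝ)) i k • b' k := by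
    funext i
    rw [← hT i]
    refine Finset.sum_congr rfl fun k _ => ?_
    simp [Int.cast_smul_eq_zsmul]
  have hpos := (Matrix.posDef_gram_of_linearIndependent (𝕜 := ℝ) hb).det_pos
  have hdet : (Matrix.gram ℝ b).det = ((Matrix.of T).det : ℝ) ^ 2 * (Matrix.gram ℝ b').det := by
    rw [hb2, gram_int_mul, Matrix.det_mul, Matrix.det_mul, Matrix.det_transpose]
    have : ((Matrix.of T).map (Int.cast : ℤ → ℝ)).det = ((Matrix.of T).det : ℝ) := by
      rw [Int.cast_det]
    rw [this]; ring
  have h0 := gram_det_nonneg b'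
  rw [hdet] at hpos ⊢
  have hne : (Matrix.of T).det ≠ 0 := by
    rintro h0; rw [h0] at hpos; simp at hpos
  have h1 : (1 : ℤ) ≤ (Matrix.of T).det ^ 2 := by
    have := sq_pos_of_ne_zero hne; omega
  have h2 : (1 : ℝ) ≤ ((Matrix.of T).det : ℝ) ^ 2 := by exact_mod_cast h1
  nlinarith

/-! ### Lattice generalities -/

lemma basis_li {E : Type*} [NormedAddCommGroup E] [InnerProductSpace ℝ E] [FiniteDimensional ℝ E]
    (L : Submodule ℤ E) [hd : DiscreteTopology L] {ι : Type*} [Fintype ι] (b : Basis ι ℤ L) :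
    LinearIndependent ℝ (fun i => (b i : E)) := by
  have hs : Submodule.span ℤ (Set.range fun i => (b i : E)) = L := by
    have : (Set.range fun i => (b i : E)) = L.subtype '' (Set.range b) := by
      rw [← Set.range_comp]; rfl
    rw [this, Submodule.span_image, b.span_eq, Submodule.map_top, Submodule.range_subtype]
  rw [linearIndependent_iff_card_eq_finrank_span]
  have := Real.finrank_eq_int_finrank_of_discrete (s := Set.range fun i => (b i : E))
    (by rw [hs]; exact hd)
  rw [Set.finrank, Set.finrank] at this
  rw [Set.finrank, this, hs, finrank_eq_card_basis b]

lemma basis_mem_span {E : Type*} [NormedAddCommGroup E] [InnerProductSpace ℝ E]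
    (L : Submodule ℤ E) {ι : Type*} (b : Basis ι ℤ L) (x : E) (hx : x ∈ L) :
    x ∈ Submodule.span ℤ (Set.range fun i => (b i : E)) := by
  have hs : Submodule.span ℤ (Set.range fun i => (b i : E)) = L := by
    have : (Set.range fun i => (b i : E)) = L.subtype '' (Set.range b) := by
      rw [← Set.range_comp]; rfl
    rw [this, Submodule.span_image, b.span_eq, Submodule.map_top, Submodule.range_subtype]
  rwa [hs]

lemma exists_basis {E : Type*} [NormedAddCommGroup E] [InnerProductSpace ℝ E]
    [FiniteDimensional ℝ E] (L : Submodule ℤ E) [hd : DiscreteTopology L] :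
    ∃ n : ℕ, Nonempty (Basis (Fin n) ℤ L) :=
  ⟨_, ⟨Module.finBasis ℤ L⟩⟩

lemma redH_spec {E : Type*} [NormedAddCommGroup E] [InnerProductSpace ℝ E]
    [FiniteDimensional ℝ E] (L : Submodule ℤ E) (hL : IsLat L) :
    ∃ b : Fin (finrank ℝ E) → E, (∀ i, b i ∈ L) ∧ LinearIndependent ℝ b ∧
      (∀ x ∈ L, x ∈ Submodule.span ℤ (Set.range b)) ∧
      redH L = (Real.sqrt (Matrix.gram ℝ b).det) ^ ((finrank ℝ E : ℝ)⁻¹) := by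
  have := hL.1
  have h := exists_basis L
  have key : ∃ (n : ℕ) (b : Basis (Fin n) ℤ L),
      covol L = Real.sqrt (Matrix.gram ℝ (fun i => (b i : E))).det := by
    refine ⟨h.choose, h.choose_spec.some, ?_⟩
    unfold covol
    rw [dif_pos h]
    rfl
  obtain ⟨n, b, hb⟩ := key
  have hli := basis_li L b
  have hn : n = finrank ℝ E := by
    have h1 : Submodule.span ℝ (Set.range fun i => (b i : E)) = ⊤ := by
      rw [eq_top_iff, ← hL.2, Submodule.span_le]
      intro x hx
      exact Submodule.span_le_restrictScalars ℤ ℝ _ (basis_mem_span L b x hx)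
    have := finrank_eq_card_basis (Basis.mk hli h1.ge)
    simpa using this.symm
  subst hn
  exact ⟨fun i => b i, fun i => (b i).2, hli, basis_mem_span L b, by rw [redH, hb]⟩

lemma isLat_latIn {E : Type*} [NormedAddCommGroup E] [InnerProductSpace ℝ E]
    (L : Submodule ℤ E) (hL : DiscreteTopology L) (F : Submodule ℝ E)
    (hF : IsRational L F) : IsLat (latIn L F) := by
  constructor
  · exact DiscreteTopology.preimage_of_continuous_injective (L : Set E)
      continuous_subtype_val Subtype.val_injective
  · apply Submodule.map_injective_of_injective F.injective_subtype
    rw [Submodule.map_span, Submodule.map_top, Submodule.range_subtype]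
    conv_rhs => rw [← hF]
    congr 1
    ext x
    constructor
    · rintro ⟨y, hy, rfl⟩
      exact ⟨hy, y.2⟩
    · rintro ⟨hx, hx'⟩
      exact ⟨⟨x, hx'⟩, hx, rfl⟩

lemma Hr_spec {E : Type*} [NormedAddCommGroup E] [InnerProductSpace ℝ E]
    [FiniteDimensional ℝ E] (L : Submodule ℤ E) (hL : DiscreteTopology L) (F : Submodule ℝ E)
    (hF : IsRational L F) :
    ∃ b : Fin (finrank ℝ F) → E, (∀ i, b i ∈ L) ∧ LinearIndependent ℝ b ∧
      (∀ x ∈ L, x ∈ F → x ∈ Submodule.span ℤ (Set.range b)) ∧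
      Hr L F = (Real.sqrt (Matrix.gram ℝ b).det) ^ ((finrank ℝ F : ℝ)⁻¹) := by
  obtain ⟨b, h1, h2, h3, h4⟩ := redH_spec _ (isLat_latIn L hL F hF)
  refine ⟨fun i => b i, fun i => h1 i, ?_, ?_, h4⟩
  · exact h2.map' F.subtype (Submodule.ker_subtype F)
  · intro x hx hxF
    have := Submodule.mem_map_of_mem (f := F.subtype.restrictScalars ℤ) (h3 ⟨x, hxF⟩ hx)
    rw [Submodule.map_span, ← Set.range_comp] at this
    exact this

/-- Lower bound on all Gram determinants of independent families in `L`. -/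
def LB {E : Type*} [NormedAddCommGroup E] [InnerProductSpace ℝ E]
    (L : Submodule ℤ E) (c : ℝ) : Prop :=
  ∀ (n : ℕ) (b : Fin n → E), (∀ i, b i ∈ L) → LinearIndependent ℝ b →
    (c ^ n) ^ 2 ≤ (Matrix.gram ℝ b).det

lemma Hr_nonneg {E : Type*} [NormedAddCommGroup E] [InnerProductSpace ℝ E]
    [FiniteDimensional ℝ E] (L : Submodule ℤ E) (hL : DiscreteTopology L) (F : Submodule ℝ E)
    (hF : IsRational L F) : 0 ≤ Hr L F := by
  obtain ⟨b, -, -, -, h⟩ := Hr_spec L hL F hF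
  rw [h]; positivity

lemma Hmin_nonneg {E : Type*} [NormedAddCommGroup E] [InnerProductSpace ℝ E]
    [FiniteDimensional ℝ E] (L : Submodule ℤ E) (hL : DiscreteTopology L) : 0 ≤ Hmin L := by
  apply Real.sInf_nonneg
  rintro _ ⟨F, -, hF, rfl⟩
  exact Hr_nonneg L hL F hF

lemma Hmin_le {E : Type*} [NormedAddCommGroup E] [InnerProductSpace ℝ E]
    [FiniteDimensional ℝ E] (L : Submodule ℤ E) (hL : DiscreteTopology L) (F : Submodule ℝ E)
    (h0 : F ≠ ⊥) (hF : IsRational L F) : Hmin L ≤ Hr L F := by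
  refine csInf_le ⟨0, ?_⟩ ⟨F, h0, hF, rfl⟩
  rintro _ ⟨F, -, hF, rfl⟩
  exact Hr_nonneg L hL F hF

lemma LB.le_Hmin {E : Type*} [NormedAddCommGroup E] [InnerProductSpace ℝ E]
    [FiniteDimensional ℝ E] [Nontrivial E] {L : Submodule ℤ E} (hL : IsLat L) {c : ℝ}
    (hc : 0 ≤ c) (h : LB L c) : c ≤ Hmin L := by
  refine le_csInf ⟨_, ⊤, top_ne_bot, ?_, rfl⟩ ?_
  · simp [IsRational, hL.2]
  rintro _ ⟨F, hF0, hF, rfl⟩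
  obtain ⟨b, h1, h2, -, h4⟩ := Hr_spec L hL.1 F hF
  have hn : finrank ℝ F ≠ 0 := by
    rw [Ne, Submodule.finrank_eq_zero]; exact hF0
  rw [h4, ← Real.pow_rpow_inv_natCast hc hn]
  refine Real.rpow_le_rpow (by positivity) (Real.le_sqrt_of_sq_le (h _ b h1 h2)) (by positivity)

lemma LB_Hmin {E : Type*} [NormedAddCommGroup E] [InnerProductSpace ℝ E]
    [FiniteDimensional ℝ E] {L : Submodule ℤ E} (hL : DiscreteTopology L) : LB L (Hmin L) := by
  intro n b hb hli
  rcases Nat.eq_zero_or_pos n with rfl | hpos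
  · simp
  set A := Submodule.span ℝ (Set.range b) with hA
  have hbA : ∀ i, b i ∈ A := fun i => Submodule.subset_span ⟨i, rfl⟩
  have hrat : IsRational L A := by
    apply le_antisymm
    · rw [Submodule.span_le]; exact Set.inter_subset_right
    · rw [hA, Submodule.span_le]
      rintro _ ⟨i, rfl⟩
      exact Submodule.subset_span ⟨hb i, hbA i⟩
  have hfr : finrank ℝ A = n := by
    rw [hA, finrank_span_eq_card hli, Fintype.card_fin]
  have hA0 : A ≠ ⊥ := by
    intro h; rw [h, finrank_bot] at hfr; omega
  obtain ⟨b', h1, h2, h3, h4⟩ := Hr_spec L hL A hrat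
  have h5 := Hmin_le L hL A hA0 hrat
  rw [h4] at h5
  clear_value A
  subst hfr
  have h6 := pow_le_pow_left₀ (Hmin_nonneg L hL) h5 (finrank ℝ A)
  rw [Real.rpow_inv_natCast_pow (by positivity) hpos.ne'] at h6
  have h7 := pow_le_pow_left₀ (pow_nonneg (Hmin_nonneg L hL) _) h6 2
  rw [Real.sq_sqrt (gram_det_nonneg b')] at h7
  exact h7.trans (gram_det_le b b' hli fun i => h3 _ (hb i) (hbA i))

lemma redH_spec' {E : Type*} [NormedAddCommGroup E] [InnerProductSpace ℝ E]
    [FiniteDimensional ℝ E] (L : Submodule ℤ E) (hL : IsLat L) {k : ℕ} (hk : finrank ℝ E = k) :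
    ∃ b : Fin k → E, (∀ i, b i ∈ L) ∧ LinearIndependent ℝ b ∧
      (∀ x ∈ L, x ∈ Submodule.span ℤ (Set.range b)) ∧
      redH L = (Real.sqrt (Matrix.gram ℝ b).det) ^ ((k : ℝ)⁻¹) := by
  subst hk; exact redH_spec L hL

lemma Hr_spec' {E : Type*} [NormedAddCommGroup E] [InnerProductSpace ℝ E]
    [FiniteDimensional ℝ E] (L : Submodule ℤ E) (hL : DiscreteTopology L) (F : Submodule ℝ E)
    (hF : IsRational L F) {k : ℕ} (hk : finrank ℝ F = k) :
    ∃ b : Fin k → E, (∀ i, b i ∈ L) ∧ LinearIndependent ℝ b ∧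
      (∀ x ∈ L, x ∈ F → x ∈ Submodule.span ℤ (Set.range b)) ∧
      Hr L F = (Real.sqrt (Matrix.gram ℝ b).det) ^ ((k : ℝ)⁻¹) := by
  subst hk; exact Hr_spec L hL F hF

/-- Gram determinants and block decompositions. -/
lemma gram_block {G : Type*} [NormedAddCommGroup G] [InnerProductSpace ℝ G]
    {ι κ : Type*} [Fintype ι] [DecidableEq ι] [Fintype κ] [DecidableEq κ]
    (k : ι → G) (z w : κ → G) (hk : LinearIndependent ℝ k) (hw : LinearIndependent ℝ w)
    (h1 : ∀ i j, inner ℝ (k i) (w j) = 0) (h2 : ∀ i j, inner ℝ (z i) (w j) = 0) :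
    (Matrix.gram ℝ k).det * (Matrix.gram ℝ w).det ≤
      (Matrix.gram ℝ (Sum.elim k (fun j => z j + w j))).det := by
  have hA := Matrix.posDef_gram_of_linearIndependent (𝕜 := ℝ) hk
  have hW := Matrix.posDef_gram_of_linearIndependent (𝕜 := ℝ) hw
  set A := Matrix.gram ℝ k with hAdef
  set W := Matrix.gram ℝ w with hWdef
  let B : Matrix ι κ ℝ := Matrix.of fun i j => inner ℝ (k i) (z j)
  let _ : Invertible A := A.invertibleOfIsUnitDet hA.det_pos.ne'.isUnit
  have e1 : Matrix.gram ℝ (Sum.elim k (fun j => z j + w j)) =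
      Matrix.fromBlocks A B B.conjTranspose (Matrix.gram ℝ z + W) := by
    ext (i | i) (j | j)
    · simp [hAdef]
    · simp [B, inner_add_right, h1]
    · simp [B, inner_add_left, real_inner_comm, h1]
    · simp [hWdef, inner_add_left, inner_add_right, h2, real_inner_comm]
  have e2 : Matrix.gram ℝ (Sum.elim k z) =
      Matrix.fromBlocks A B B.conjTranspose (Matrix.gram ℝ z) := by
    ext (i | i) (j | j)
    · simp [hAdef]
    · simp [B]
    · simp [B, real_inner_comm]
    · simp
  have hS : (Matrix.gram ℝ z - B.conjTranspose * A⁻¹ * B).PosSemidef := by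
    rw [← hA.fromBlocks₁₁, ← e2]
    exact Matrix.posSemidef_gram ℝ _
  rw [e1, Matrix.det_fromBlocks₁₁, Matrix.invOf_eq_nonsing_inv]
  have e3 : Matrix.gram ℝ z + W - B.conjTranspose * A⁻¹ * B =
      W + (Matrix.gram ℝ z - B.conjTranspose * A⁻¹ * B) := by abel
  rw [e3]
  exact mul_le_mul_of_nonneg_left (det_le_det_add hW hS) hA.det_pos.le

lemma gram_tensor {E F G : Type*} [NormedAddCommGroup E] [InnerProductSpace ℝ E]
    [NormedAddCommGroup F] [InnerProductSpace ℝ F] [NormedAddCommGroup G] [InnerProductSpace ℝ G]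
    (t : E →ₗ[ℝ] F →ₗ[ℝ] G) (ht : IsTensor t) {n : ℕ} (x : Fin n → E) (v : F) :
    (Matrix.gram ℝ (fun i => t (x i) v)).det = (‖v‖ ^ n) ^ 2 * (Matrix.gram ℝ x).det := by
  have : Matrix.gram ℝ (fun i => t (x i) v) = (‖v‖ ^ 2) • Matrix.gram ℝ x := by
    ext i j
    simp [ht.2, mul_comm]
  rw [this, Matrix.det_smul, Fintype.card_fin]
  ring

lemma tensor_li {E F G : Type*} [NormedAddCommGroup E] [InnerProductSpace ℝ E]
    [NormedAddCommGroup F] [InnerProductSpace ℝ F] [NormedAddCommGroup G] [InnerProductSpace ℝ G]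
    (t : E →ₗ[ℝ] F →ₗ[ℝ] G) (ht : IsTensor t) {n : ℕ} (x : Fin n → E) (hx : LinearIndependent ℝ x)
    (v : F) (hv : v ≠ 0) : LinearIndependent ℝ (fun i => t (x i) v) := by
  apply Matrix.linearIndependent_of_det_gram_ne_zero (𝕜 := ℝ)
  rw [gram_tensor t ht]
  have := (Matrix.posDef_gram_of_linearIndependent (𝕜 := ℝ) hx).det_pos
  have := norm_pos_iff.mpr hv
  positivity

/-- A two-dimensional non-stable lattice has a good basis. -/
lemma exists_good_basis {F : Type*} [NormedAddCommGroup F] [InnerProductSpace ℝ F]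
    [FiniteDimensional ℝ F] (M : Submodule ℤ F) (hM : IsLat M)
    (hdim : finrank ℝ F = 2) (hns : ¬ Stable M) :
    ∃ v u : F, v ∈ M ∧ u ∈ M ∧ v ≠ 0 ∧ (∀ x ∈ M, ∃ a b : ℤ, x = a • v + b • u) ∧ LB M ‖v‖ ∧
      ‖v‖ ^ 2 * ‖v‖ ^ 2 ≤ ‖v‖ ^ 2 * ‖u‖ ^ 2 - (inner ℝ v u : ℝ) ^ 2 := by
  obtain ⟨b, hbM, hbli, hbs, hred⟩ := redH_spec' M hM hdim
  have hmin2 : ∀ b' : Fin 2 → F, (∀ i, b' i ∈ M) → LinearIndependent ℝ b' →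
      (Matrix.gram ℝ b).det ≤ (Matrix.gram ℝ b').det := fun b' h h' =>
    gram_det_le b' b h' fun i => hbs _ (h i)
  have hgb := (Matrix.posDef_gram_of_linearIndependent (𝕜 := ℝ) hbli).det_pos
  -- a destabilizing line
  have hline : ∃ A : Submodule ℝ F, IsRational M A ∧ finrank ℝ A = 1 ∧ Hr M A ≤ redH M := by
    have hrk : ∀ A : Submodule ℝ F, A ≠ ⊥ → finrank ℝ A ≠ 1 → finrank ℝ A = 2 := by
      intro A hA hA1
      have h1 := Submodule.finrank_le A
      have h2 : finrank ℝ A ≠ 0 := by rw [Ne, Submodule.finrank_eq_zero]; exact hA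
      omega
    by_cases hss : Semistable M
    · have : ∃ A : Submodule ℝ F, A ≠ ⊥ ∧ A ≠ ⊤ ∧ IsRational M A ∧ Hr M A ≤ redH M := by
        by_contra hcon
        apply hns
        refine ⟨hss, fun A h1 h2 h3 => ?_⟩
        by_contra h4
        exact hcon ⟨A, h1, h2, h3, not_lt.mp h4⟩
      obtain ⟨A, h1, h2, h3, h4⟩ := this
      refine ⟨A, h3, ?_, h4⟩
      by_contra h5
      have h6 := hrk A h1 h5
      exact h2 (Submodule.eq_top_of_finrank_eq (by rw [h6, hdim]))
    · have : ∃ A : Submodule ℝ F, A ≠ ⊥ ∧ IsRational M A ∧ Hr M A < redH M := by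
        by_contra hcon
        apply hss
        intro A h1 h2
        by_contra h4
        exact hcon ⟨A, h1, h2, not_le.mp h4⟩
      obtain ⟨A, h1, h2, h3⟩ := this
      refine ⟨A, h2, ?_, h3.le⟩
      by_contra h5
      have h6 := hrk A h1 h5
      obtain ⟨b', c1, c2, -, c4⟩ := Hr_spec' M hM.1 A h2 h6
      rw [c4, hred] at h3
      refine absurd h3 (not_lt.mpr ?_)
      exact Real.rpow_le_rpow (by positivity) (Real.sqrt_le_sqrt (hmin2 b' c1 c2)) (by positivity)
  obtain ⟨A, hA, hA1, hAle⟩ := hline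
  obtain ⟨w, hwM, hwli, -, hwH⟩ := Hr_spec' M hM.1 A hA hA1
  have hw0 : w 0 ≠ 0 := hwli.ne_zero 0
  have hw4 : (‖w 0‖ ^ 2) ^ 2 ≤ (Matrix.gram ℝ b).det := by
    have : Hr M A = ‖w 0‖ := by
      rw [hwH, Matrix.det_fin_one, Matrix.gram_apply, real_inner_self_eq_norm_sq,
        Real.sqrt_sq (norm_nonneg _)]
      simp
    rw [this, hred] at hAle
    have h2 := pow_le_pow_left₀ (norm_nonneg _) hAle 2
    rw [Real.rpow_inv_natCast_pow (by positivity) two_ne_zero] at h2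
    have h3 := pow_le_pow_left₀ (by positivity) h2 2
    rwa [Real.sq_sqrt hgb.le] at h3
  -- shortest vector
  obtain ⟨v, hvM, hv0, hvmin⟩ : ∃ v ∈ M, v ≠ 0 ∧ ∀ x ∈ M, x ≠ 0 → ‖v‖ ≤ ‖x‖ := by
    have hd := hM.1
    have hfin : (Metric.closedBall (0 : F) ‖w 0‖ ∩ (M : Set F)).Finite := by
      have hcl : IsClosed (M.toAddSubgroup : Set F) :=
        @AddSubgroup.isClosed_of_discrete F _ _ _ _ M.toAddSubgroup hd
      exact Metric.finite_isBounded_inter_isClosed ⟨hd⟩ Metric.isBounded_closedBall hcl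
    have hfin2 : (Metric.closedBall (0 : F) ‖w 0‖ ∩ (M : Set F) ∩ {x | x ≠ 0}).Finite :=
      hfin.subset Set.inter_subset_left
    obtain ⟨v, ⟨⟨hv1, hv2⟩, hv3⟩, hv4⟩ := Set.exists_min_image _ (fun x => ‖x‖) hfin2
      ⟨w 0, ⟨by simp, hwM 0⟩, hw0⟩
    refine ⟨v, hv2, hv3, fun x hx hx0 => ?_⟩
    by_cases hxw : ‖x‖ ≤ ‖w 0‖
    · exact hv4 x ⟨⟨by simpa using hxw, hx⟩, hx0⟩
    · have : ‖v‖ ≤ ‖w 0‖ := by simpa using hv1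
      linarith
  have hv4 : (‖v‖ ^ 2) ^ 2 ≤ (Matrix.gram ℝ b).det := by
    refine le_trans ?_ hw4
    have := hvmin _ (hwM 0) hw0
    gcongr
  have hrep : ∀ x ∈ M, ∃ a c : ℤ, x = a • b 0 + c • b 1 := by
    intro x hx
    obtain ⟨c, hc⟩ := (Submodule.mem_span_range_iff_exists_fun ℤ).mp (hbs x hx)
    exact ⟨c 0, c 1, by rw [← hc, Fin.sum_univ_two]⟩
  obtain ⟨a, c, hac⟩ := hrep v hvM
  have hcop : Int.gcd a c = 1 := by
    obtain ⟨a', ha'⟩ := Int.gcd_dvd_left a c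
    obtain ⟨c', hc'⟩ := Int.gcd_dvd_right a c
    set d : ℕ := Int.gcd a c
    have hv' : v = (d : ℤ) • (a' • b 0 + c' • b 1) := by
      rw [hac, smul_add, smul_smul, smul_smul, ← ha', ← hc']
    have hmem : a' • b 0 + c' • b 1 ∈ M :=
      M.add_mem (M.smul_mem _ (hbM 0)) (M.smul_mem _ (hbM 1))
    have hne : a' • b 0 + c' • b 1 ≠ 0 := by
      intro h; rw [h, smul_zero] at hv'; exact hv0 hv'
    have h1 := hvmin _ hmem hne
    have hpos := norm_pos_iff.mpr hne
    have hnv : ‖v‖ = d * ‖a' • b 0 + c' • b 1‖ := by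
      conv_lhs => rw [hv', ← Int.cast_smul_eq_zsmul ℝ, norm_smul]
      simp
    have hd0 : d ≠ 0 := by
      intro h; rw [h] at hv'; simp at hv'; exact hv0 hv'
    rw [hnv] at h1
    have : (d : ℝ) ≤ 1 := by
      by_contra hcon
      nlinarith
    have : d ≤ 1 := by exact_mod_cast this
    omega
  obtain ⟨s, t, hst⟩ := Int.isCoprime_iff_gcd_eq_one.mpr hcop
  refine ⟨v, (-t) • b 0 + s • b 1, hvM, ?_, hv0, ?_, ?_, ?_⟩
  · exact M.add_mem (M.smul_mem _ (hbM 0)) (M.smul_mem _ (hbM 1))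
  · intro x hx
    obtain ⟨p, q, rfl⟩ := hrep x hx
    refine ⟨p * s + q * t, -(p * c) + q * a, ?_⟩
    rw [hac]
    have e0 : b 0 = (s * a + t * c) • b 0 := by rw [hst, one_smul]
    have e1 : b 1 = (s * a + t * c) • b 1 := by rw [hst, one_smul]
    conv_lhs => rw [e0, e1]
    module
  · intro n b' hb' hli
    have hn : n ≤ 2 := by
      have := hli.fintype_card_le_finrank
      rwa [Fintype.card_fin, hdim] at this
    interval_cases n
    · simp
    · rw [Matrix.det_fin_one, Matrix.gram_apply, real_inner_self_eq_norm_sq, pow_one]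
      have := hvmin _ (hb' 0) (hli.ne_zero 0)
      gcongr
    · exact hv4.trans (hmin2 b' hb' hli)
  · have hdet : (Matrix.gram ℝ b).det =
        ‖b 0‖ ^ 2 * ‖b 1‖ ^ 2 - (inner ℝ (b 0) (b 1) : ℝ) ^ 2 := by
      rw [Matrix.det_fin_two]
      simp only [Matrix.gram_apply, real_inner_self_eq_norm_sq]
      rw [real_inner_comm (b 0) (b 1)]
      ring
    rw [← sq]
    refine hv4.trans (le_of_eq ?_)
    rw [hdet, hac]
    have hst' : (s : ℝ) * a + t * c = 1 := by exact_mod_cast hst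
    simp only [← Int.cast_smul_eq_zsmul ℝ, ← real_inner_self_eq_norm_sq, inner_add_left,
      inner_add_right, real_inner_smul_left, real_inner_smul_right]
    rw [real_inner_comm (b 0) (b 1)]
    push_cast
    generalize (inner ℝ (b 0) (b 0) : ℝ) = X
    generalize (inner ℝ (b 1) (b 1) : ℝ) = Y
    generalize (inner ℝ (b 0) (b 1) : ℝ) = Z
    have h2 : ((s : ℝ) * a + t * c) ^ 2 = 1 := by rw [hst']; norm_num
    linear_combination (-(X * Y - Z ^ 2)) * h2

lemma tensor_finite {E F G : Type*} [NormedAddCommGroup E] [InnerProductSpace ℝ E]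
    [NormedAddCommGroup F] [InnerProductSpace ℝ F] [NormedAddCommGroup G] [InnerProductSpace ℝ G]
    [FiniteDimensional ℝ E] [FiniteDimensional ℝ F]
    (t : E →ₗ[ℝ] F →ₗ[ℝ] G) (ht : IsTensor t) : FiniteDimensional ℝ G :=
  Module.Finite.equiv (LinearEquiv.ofBijective (TensorProduct.lift t) ht.1)

lemma mem_tensorLat {E F G : Type*} [NormedAddCommGroup E] [InnerProductSpace ℝ E]
    [NormedAddCommGroup F] [InnerProductSpace ℝ F] [NormedAddCommGroup G] [InnerProductSpace ℝ G]
    (t : E →ₗ[ℝ] F →ₗ[ℝ] G) {L : Submodule ℤ E} {M : Submodule ℤ F} {x : E} {y : F}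
    (hx : x ∈ L) (hy : y ∈ M) : t x y ∈ tensorLat t L M :=
  Submodule.subset_span ⟨x, hx, y, hy, rfl⟩

lemma isLat_tensorLat {E F G : Type*} [NormedAddCommGroup E] [InnerProductSpace ℝ E]
    [NormedAddCommGroup F] [InnerProductSpace ℝ F] [NormedAddCommGroup G] [InnerProductSpace ℝ G]
    [FiniteDimensional ℝ E] [FiniteDimensional ℝ F]
    (t : E →ₗ[ℝ] F →ₗ[ℝ] G) (ht : IsTensor t) (L : Submodule ℤ E) (hL : IsLat L)
    (M : Submodule ℤ F) (hM : IsLat M) : IsLat (tensorLat t L M) := by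
  have := tensor_finite t ht
  obtain ⟨b, hb1, hb2, hb3, -⟩ := redH_spec L hL
  obtain ⟨f, hf1, hf2, hf3, -⟩ := redH_spec M hM
  let bE : Basis (Fin (finrank ℝ E)) ℝ E :=
    basisOfLinearIndependentOfCardEqFinrank' b hb2 (by simp)
  let bF : Basis (Fin (finrank ℝ F)) ℝ F :=
    basisOfLinearIndependentOfCardEqFinrank' f hf2 (by simp)
  let B := (bE.tensorProduct bF).map (LinearEquiv.ofBijective (TensorProduct.lift t) ht.1)
  have hB : ∀ i j, B (i, j) = t (b i) (f j) := by
    intro i j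
    simp [B, bE, bF]
  constructor
  · have hle : tensorLat t L M ≤ Submodule.span ℤ (Set.range B) := by
      rw [tensorLat, Submodule.span_le]
      rintro _ ⟨x, hx, y, hy, rfl⟩
      obtain ⟨p, rfl⟩ := (Submodule.mem_span_range_iff_exists_fun ℤ).mp (hb3 x hx)
      obtain ⟨q, rfl⟩ := (Submodule.mem_span_range_iff_exists_fun ℤ).mp (hf3 y hy)
      simp only [map_sum, LinearMap.sum_apply, map_zsmul, LinearMap.smul_apply]
      refine Submodule.sum_mem _ fun i _ => Submodule.smul_mem _ _ ?_
      refine Submodule.sum_mem _ fun j _ => Submodule.smul_mem _ _ ?_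
      rw [← hB]
      exact Submodule.subset_span ⟨_, rfl⟩
    have hd : DiscreteTopology (Submodule.span ℤ (Set.range B)) := inferInstance
    exact DiscreteTopology.of_subset hd hle
  · rw [eq_top_iff, ← B.span_eq, Submodule.span_le]
    rintro _ ⟨⟨i, j⟩, rfl⟩
    rw [hB]
    exact Submodule.subset_span (mem_tensorLat t (hb1 i) (hf1 j))

/-- The main lower bound. -/
lemma LB_tensor {E F G : Type*} [NormedAddCommGroup E] [InnerProductSpace ℝ E]
    [NormedAddCommGroup F] [InnerProductSpace ℝ F] [NormedAddCommGroup G] [InnerProductSpace ℝ G]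
    [FiniteDimensional ℝ E] [FiniteDimensional ℝ F]
    (t : E →ₗ[ℝ] F →ₗ[ℝ] G) (ht : IsTensor t) (L : Submodule ℤ E) (hL : DiscreteTopology L)
    (M : Submodule ℤ F) (v u : F) (hv0 : v ≠ 0)
    (hvu : ∀ x ∈ M, ∃ a b : ℤ, x = a • v + b • u)
    (hdet : ‖v‖ ^ 2 * ‖v‖ ^ 2 ≤ ‖v‖ ^ 2 * ‖u‖ ^ 2 - (inner ℝ v u : ℝ) ^ 2)
    (c : ℝ) (_hc : 0 ≤ c) (hLB : LB L c) : LB (tensorLat t L M) (c * ‖v‖) := by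
  intro n b hb hli
  have hvpos := norm_pos_iff.mpr hv0
  -- decomposition of elements
  have hdec : ∀ g ∈ tensorLat t L M, ∃ x ∈ L, ∃ y ∈ L, g = t x v + t y u := by
    intro g hg
    induction hg using Submodule.span_induction with
    | mem g hg =>
      obtain ⟨x, hx, y, hy, rfl⟩ := hg
      obtain ⟨p, q, rfl⟩ := hvu y hy
      refine ⟨p • x, L.smul_mem _ hx, q • x, L.smul_mem _ hx, ?_⟩
      simp
    | zero => exact ⟨0, L.zero_mem, 0, L.zero_mem, by simp⟩
    | add g g' _ _ h h' =>
      obtain ⟨x, hx, y, hy, rfl⟩ := h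
      obtain ⟨x', hx', y', hy', rfl⟩ := h'
      refine ⟨x + x', L.add_mem hx hx', y + y', L.add_mem hy hy', ?_⟩
      simp only [map_add, LinearMap.add_apply]
      abel
    | smul a g _ h =>
      obtain ⟨x, hx, y, hy, rfl⟩ := h
      refine ⟨a • x, L.smul_mem _ hx, a • y, L.smul_mem _ hy, ?_⟩
      simp
  let N : Submodule ℤ G := Submodule.span ℤ (Set.range b)
  have hNle : N ≤ tensorLat t L M := by
    rw [Submodule.span_le]; rintro _ ⟨i, rfl⟩; exact hb i
  let K : Submodule ℤ E := L ⊓ N.comap ((t.flip v).restrictScalars ℤ)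
  have hK : ∀ x, x ∈ K ↔ x ∈ L ∧ t x v ∈ N := fun x => Iff.rfl
  let R : Submodule ℤ E :=
    { carrier := {y | y ∈ L ∧ ∃ x ∈ L, t x v + t y u ∈ N}
      zero_mem' := ⟨L.zero_mem, 0, L.zero_mem, by simp⟩
      add_mem' := by
        rintro y y' ⟨hy, x, hx, h⟩ ⟨hy', x', hx', h'⟩
        refine ⟨L.add_mem hy hy', x + x', L.add_mem hx hx', ?_⟩
        have := N.add_mem h h'
        simp only [map_add, LinearMap.add_apply]
        convert this using 1
        abel
      smul_mem' := by
        rintro a y ⟨hy, x, hx, h⟩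
        refine ⟨L.smul_mem _ hy, a • x, L.smul_mem _ hx, ?_⟩
        have := N.smul_mem a h
        simpa using this }
  have hR : ∀ y, y ∈ R ↔ y ∈ L ∧ ∃ x ∈ L, t x v + t y u ∈ N := fun x => Iff.rfl
  have hKd : DiscreteTopology K := DiscreteTopology.of_subset hL inf_le_left
  have hRd : DiscreteTopology R := DiscreteTopology.of_subset hL fun y hy => ((hR y).mp hy).1
  obtain ⟨r, x, hxli, hxs, hxK⟩ : ∃ (r : ℕ) (x : Fin r → E), LinearIndependent ℝ x ∧
      (∀ e ∈ K, e ∈ Submodule.span ℤ (Set.range x)) ∧ ∀ i, x i ∈ K := by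
    obtain ⟨r, ⟨bK⟩⟩ := exists_basis K
    exact ⟨r, fun i => bK i, basis_li K bK, basis_mem_span K bK, fun i => (bK i).2⟩
  obtain ⟨s, y, hyli, hys, hyR⟩ : ∃ (s : ℕ) (y : Fin s → E), LinearIndependent ℝ y ∧
      (∀ e ∈ R, e ∈ Submodule.span ℤ (Set.range y)) ∧ ∀ i, y i ∈ R := by
    obtain ⟨s, ⟨bR⟩⟩ := exists_basis R
    exact ⟨s, fun i => bR i, basis_li R bR, basis_mem_span R bR, fun i => (bR i).2⟩
  choose z hzL hzN using fun j => ((hR _).mp (hyR j)).2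
  -- orthogonalize `u` with respect to `v`
  set μ : ℝ := inner ℝ v u / ‖v‖ ^ 2 with hμ
  set u' : F := u - μ • v with hu'
  have hvu' : (inner ℝ v u' : ℝ) = 0 := by
    rw [hu', inner_sub_right, real_inner_smul_right, real_inner_self_eq_norm_sq, hμ]
    field_simp
    ring
  have hu'n : ‖v‖ ≤ ‖u'‖ := by
    have e : ‖v‖ ^ 2 * ‖u'‖ ^ 2 = ‖v‖ ^ 2 * ‖u‖ ^ 2 - (inner ℝ v u : ℝ) ^ 2 := by
      have : ‖u'‖ ^ 2 = inner ℝ u u' - μ * inner ℝ v u' := by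
        rw [← real_inner_self_eq_norm_sq]
        conv_lhs => rw [hu', inner_sub_left, real_inner_smul_left, ← hu']
      rw [this, hvu', hu', inner_sub_right, real_inner_smul_right, real_inner_self_eq_norm_sq,
        real_inner_comm v u, hμ]
      field_simp
      ring
    rw [← e] at hdet
    have := le_of_mul_le_mul_left hdet (by positivity)
    exact le_of_sq_le_sq this (norm_nonneg _)
  have hu'0 : u' ≠ 0 := norm_pos_iff.mp (hvpos.trans_le hu'n)
  let k : Fin r → G := fun i => t (x i) v
  let zz : Fin s → G := fun j => t (z j + μ • y j) v
  let w : Fin s → G := fun j => t (y j) u'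
  have hkli : LinearIndependent ℝ k := tensor_li t ht x hxli v hv0
  have hwli : LinearIndependent ℝ w := tensor_li t ht y hyli u' hu'0
  have hblock := gram_block k zz w hkli hwli
    (fun i j => by simp only [k, w]; rw [ht.2, hvu', mul_zero])
    (fun i j => by simp only [zz, w]; rw [ht.2, hvu', mul_zero])
  set b' : Fin r ⊕ Fin s → G := Sum.elim k (fun j => zz j + w j) with hb'
  have hb'2 : ∀ j, b' (Sum.inr j) = t (z j) v + t (y j) u := by
    intro j
    simp only [hb', Sum.elim_inr, zz, w, hu', map_add, map_sub, map_smul, LinearMap.add_apply,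
      LinearMap.smul_apply]
    abel
  have hkpos := (Matrix.posDef_gram_of_linearIndependent (𝕜 := ℝ) hkli).det_pos
  have hwpos := (Matrix.posDef_gram_of_linearIndependent (𝕜 := ℝ) hwli).det_pos
  have hb'li : LinearIndependent ℝ b' :=
    Matrix.linearIndependent_of_det_gram_ne_zero (𝕜 := ℝ)
      ((mul_pos hkpos hwpos).trans_le hblock).ne'
  have hb'N : ∀ i, b' i ∈ N := by
    rintro (i | j)
    · exact ((hK _).mp (hxK i)).2
    · rw [hb'2]; exact hzN j
  have hNb' : ∀ g ∈ N, g ∈ Submodule.span ℤ (Set.range b') := by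
    intro g hg
    obtain ⟨p, hp, q, hq, rfl⟩ := hdec g (hNle hg)
    have hqR : q ∈ R := (hR q).mpr ⟨hq, p, hp, hg⟩
    obtain ⟨a, ha⟩ := (Submodule.mem_span_range_iff_exists_fun ℤ).mp (hys q hqR)
    have hsum : ∑ j, a j • b' (Sum.inr j) = t (∑ j, a j • z j) v + t q u := by
      rw [← ha]
      simp only [hb'2, smul_add, Finset.sum_add_distrib, map_sum, map_zsmul,
        LinearMap.sum_apply, LinearMap.smul_apply]
    have hsumN : ∑ j, a j • b' (Sum.inr j) ∈ N :=
      N.sum_mem fun j _ => N.smul_mem _ (hb'N _)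
    have hsumS : ∑ j, a j • b' (Sum.inr j) ∈ Submodule.span ℤ (Set.range b') :=
      Submodule.sum_mem _ fun j _ => Submodule.smul_mem _ _ (Submodule.subset_span ⟨_, rfl⟩)
    have hdiff : t p v + t q u = t (p - ∑ j, a j • z j) v + ∑ j, a j • b' (Sum.inr j) := by
      rw [hsum, map_sub, LinearMap.sub_apply]; abel
    have hpK : p - ∑ j, a j • z j ∈ K := by
      refine (hK _).mpr ⟨L.sub_mem hp (L.sum_mem fun j _ => L.smul_mem _ (hzL j)), ?_⟩
      have := N.sub_mem hg hsumN
      rwa [hdiff, add_sub_cancel_right] at this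
    rw [hdiff]
    refine Submodule.add_mem _ ?_ hsumS
    obtain ⟨a', ha'⟩ := (Submodule.mem_span_range_iff_exists_fun ℤ).mp (hxs _ hpK)
    rw [← ha']
    simp only [map_sum, map_zsmul, LinearMap.sum_apply, LinearMap.smul_apply]
    exact Submodule.sum_mem _ fun i _ => Submodule.smul_mem _ _
      (Submodule.subset_span ⟨Sum.inl i, rfl⟩)
  have hspan : Submodule.span ℝ (Set.range b) = Submodule.span ℝ (Set.range b') := by
    apply le_antisymm
    · rw [Submodule.span_le]
      rintro _ ⟨i, rfl⟩
      exact Submodule.span_le_restrictScalars ℤ ℝ _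
        (hNb' _ (Submodule.subset_span ⟨i, rfl⟩))
    · rw [Submodule.span_le]
      rintro _ ⟨i, rfl⟩
      exact Submodule.span_le_restrictScalars ℤ ℝ _ (hb'N i)
  have hn : n = r + s := by
    have h1 := finrank_span_eq_card hli
    have h2 := finrank_span_eq_card hb'li
    rw [hspan, h2] at h1
    simpa using h1.symm
  let e : Fin n ≃ Fin r ⊕ Fin s := (finCongr hn).trans finSumFinEquiv.symm
  have hfin := gram_det_le b (b' ∘ e) hli (fun i => by
    rw [EquivLike.range_comp]
    exact hNb' _ (Submodule.subset_span ⟨i, rfl⟩))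
  have hre : (Matrix.gram ℝ (b' ∘ e)).det = (Matrix.gram ℝ b').det :=
    Matrix.det_submatrix_equiv_self e (Matrix.gram ℝ b')
  rw [hre] at hfin
  refine le_trans ?_ (hblock.trans hfin)
  rw [gram_tensor t ht x v, gram_tensor t ht y u', hn]
  have h1 := hLB r x (fun i => ((hK _).mp (hxK i)).1) hxli
  have h2 := hLB s y (fun i => ((hR _).mp (hyR i)).1) hyli
  calc ((c * ‖v‖) ^ (r + s)) ^ 2
      = ((‖v‖ ^ r) ^ 2 * (c ^ r) ^ 2) * ((‖v‖ ^ s) ^ 2 * (c ^ s) ^ 2) := by ring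
    _ ≤ _ := by
        have h0 := gram_det_nonneg x
        have h0' : 0 ≤ (‖v‖ ^ r) ^ 2 * (Matrix.gram ℝ x).det := by positivity
        gcongr

/-- If `(F, M)` is a 2-dimensional Euclidean lattice which is not stable, then
tensor multiplicativity of `H_min` holds for `(E, L) ⊗ (F, M)` for every Euclidean lattice
`(E, L)`. -/
theorem statement3 {F : Type*} [NormedAddCommGroup F] [InnerProductSpace ℝ F]
    [FiniteDimensional ℝ F] (M : Submodule ℤ F) (hM : IsLat M)
    (hdim : finrank ℝ F = 2) (hns : ¬ Stable M) :
    ∀ (E : Type*) [NormedAddCommGroup E] [InnerProductSpace ℝ E] [FiniteDimensional ℝ E]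
      (L : Submodule ℤ E), IsLat L →
      ∀ (G : Type*) [NormedAddCommGroup G] [InnerProductSpace ℝ G]
        (tp : E →ₗ[ℝ] F →ₗ[ℝ] G), IsTensor tp →
        Hmin (tensorLat tp L M) = Hmin L * Hmin M := by
  intro E _ _ _ L hL G _ _ tp ht
  have hG := tensor_finite tp ht
  have hGL := isLat_tensorLat tp ht L hL M hM
  rcases subsingleton_or_nontrivial E with hE | hE
  · have hG0 : Subsingleton G := by
      have : Subsingleton (TensorProduct ℝ E F) := inferInstance
      exact (Equiv.ofBijective _ ht.1).symm.subsingleton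
    have h1 : Hmin L = 0 := by
      rw [Hmin]
      convert Real.sInf_empty
      ext h
      simp only [Set.mem_ofPred_eq, Set.mem_empty_iff_false, iff_false]
      rintro ⟨A, hA, -⟩
      exact hA (Subsingleton.elim _ _)
    have h2 : Hmin (tensorLat tp L M) = 0 := by
      rw [Hmin]
      convert Real.sInf_empty
      ext h
      simp only [Set.mem_ofPred_eq, Set.mem_empty_iff_false, iff_false]
      rintro ⟨A, hA, -⟩
      exact hA (Subsingleton.elim _ _)
    rw [h1, h2, zero_mul]
  · obtain ⟨v, u, hvM, huM, hv0, hvu, hLBM, hdet⟩ := exists_good_basis M hM hdim hns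
    have hvpos := norm_pos_iff.mpr hv0
    have hF : Nontrivial F := ⟨v, 0, hv0⟩
    have hHM : Hmin M = ‖v‖ := by
      apply le_antisymm
      · have := LB_Hmin hM.1 1 (fun _ => v) (fun _ => hvM)
          (LinearIndependent.of_subsingleton 0 hv0)
        rw [Matrix.det_fin_one, Matrix.gram_apply, real_inner_self_eq_norm_sq, pow_one] at this
        exact le_of_sq_le_sq this (norm_nonneg _)
      · exact hLBM.le_Hmin hM (norm_nonneg _)
    have hGn : Nontrivial G := by
      obtain ⟨x, hx⟩ := exists_ne (0 : E)
      refine ⟨tp x v, 0, fun h => ?_⟩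
      have := ht.2 x x v v
      rw [h, inner_zero_left] at this
      simp [hx, hv0] at this
    have hHL := Hmin_nonneg L hL.1
    have hHG := Hmin_nonneg _ hGL.1
    rw [hHM]
    apply le_antisymm
    · rw [← div_le_iff₀ hvpos]
      refine LB.le_Hmin hL (by positivity) ?_
      intro n b hb hli
      have := LB_Hmin hGL.1 n (fun i => tp (b i) v) (fun i => mem_tensorLat tp (hb i) hvM)
        (tensor_li tp ht b hli v hv0)
      rw [gram_tensor tp ht] at this
      rw [div_pow, div_pow, div_le_iff₀ (by positivity)]
      linarith
    · exact (LB_tensor tp ht L hL.1 M v u hv0 hvu hdet _ hHL (LB_Hmin hL.1)).le_Hmin hGL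
        (by positivity)

end EucLat
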